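/- Let ε be a real number with 0 ≤ ε < 3/4 and let d : Fin 4 → ℝ satisfy d 0 = 1, 0 < d i ≤ 1 for all i ≠ 0, and Σ_{i≠0} d i = 3 − 4ε. Then the sampling overhead factor satisfies ((1/4)·Σ_{i} |(H.mulVec (fun j => (d j)⁻¹)) i|)² − 1 ≥ 4ε/(1 − ε)². -/

import Mathlib

open Matrix Finset

/-- The 4×4 real Hadamard matrix whose columns are the Pauli-transfer-matrix
diagonals of the single-qubit Pauli operators I, X, Y, Z. -/
def Hmat : Matrix (Fin 4) (Fin 4) ℝ :=
  !![1, 1, 1, 1;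
     1, 1, -1, -1;
     1, -1, 1, -1;
     1, -1, -1, 1]

/-- Lower bound on the sampling overhead factor of a single-qubit Pauli channel
with gate error probability ε. -/
theorem sof_lower_bound_single_qubit_pauli
    (ε : ℝ) (hε0 : 0 ≤ ε) (hε1 : ε < 3 / 4) (d : Fin 4 → ℝ)
    (hd0 : d 0 = 1)
    (hdpos : ∀ i : Fin 4, i ≠ 0 → 0 < d i)
    (hdle : ∀ i : Fin 4, i ≠ 0 → d i ≤ 1)
    (hsum : ∑ i ∈ Finset.univ.filter (fun i : Fin 4 => i ≠ 0), d i = 3 - 4 * ε) :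
    ((1 / 4) * ∑ i, |(Hmat.mulVec (fun j => (d j)⁻¹)) i|) ^ 2 - 1 ≥
      4 * ε / (1 - ε) ^ 2 := by
  have h1 := hdpos 1 (by decide)
  have h2 := hdpos 2 (by decide)
  have h3 := hdpos 3 (by decide)
  have hs : d 1 + d 2 + d 3 = 3 - 4 * ε := by
    rw [← hsum, Finset.sum_filter]
    simp [Fin.sum_univ_four]
  have ht : 0 < 3 - 4 * ε := by linarith
  have he : 0 < 1 - ε := by linarith
  have key : ∀ x : ℝ, 0 < x → 6 / (3 - 4 * ε) - 9 * x / (3 - 4 * ε) ^ 2 ≤ x⁻¹ := by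
    intro x hx
    have h : x⁻¹ - (6 / (3 - 4 * ε) - 9 * x / (3 - 4 * ε) ^ 2)
        = ((3 - 4 * ε) - 3 * x) ^ 2 / (x * (3 - 4 * ε) ^ 2) := by
      field_simp
      ring
    have h' : 0 ≤ ((3 - 4 * ε) - 3 * x) ^ 2 / (x * (3 - 4 * ε) ^ 2) := by positivity
    linarith
  have k1 := key _ h1
  have k2 := key _ h2
  have k3 := key _ h3
  have hinv : 9 / (3 - 4 * ε) ≤ (d 1)⁻¹ + (d 2)⁻¹ + (d 3)⁻¹ := by
    have e : 9 / (3 - 4 * ε) = 18 / (3 - 4 * ε) - 9 * (d 1 + d 2 + d 3) / (3 - 4 * ε) ^ 2 := by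
      rw [hs]
      field_simp
      ring
    have e2 : 18 / (3 - 4 * ε) - 9 * (d 1 + d 2 + d 3) / (3 - 4 * ε) ^ 2
        = (6 / (3 - 4 * ε) - 9 * d 1 / (3 - 4 * ε) ^ 2)
        + (6 / (3 - 4 * ε) - 9 * d 2 / (3 - 4 * ε) ^ 2)
        + (6 / (3 - 4 * ε) - 9 * d 3 / (3 - 4 * ε) ^ 2) := by ring
    linarith
  have hb : (1 + ε) / (1 - ε) ≤ (9 / (3 - 4 * ε) - 1) / 2 := by
    have h : (9 / (3 - 4 * ε) - 1) / 2 - (1 + ε) / (1 - ε)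
        = 2 * ε ^ 2 / ((3 - 4 * ε) * (1 - ε)) := by
      field_simp
      ring
    have h' : 0 ≤ 2 * ε ^ 2 / ((3 - 4 * ε) * (1 - ε)) := by positivity
    linarith
  have hn : (1 + ε) / (1 - ε) ≤ (1 / 4) * ∑ i, |(Hmat.mulVec (fun j => (d j)⁻¹)) i| := by
    have g0 : (Hmat.mulVec (fun j => (d j)⁻¹)) 0 = 1 + (d 1)⁻¹ + (d 2)⁻¹ + (d 3)⁻¹ := by
      simp [Hmat, Matrix.mulVec, dotProduct, Fin.sum_univ_four, hd0]
    have g1 : (Hmat.mulVec (fun j => (d j)⁻¹)) 1 = 1 + (d 1)⁻¹ - (d 2)⁻¹ - (d 3)⁻¹ := by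
      simp [Hmat, Matrix.mulVec, dotProduct, Fin.sum_univ_four, hd0]
      try ring
    have g2 : (Hmat.mulVec (fun j => (d j)⁻¹)) 2 = 1 - (d 1)⁻¹ + (d 2)⁻¹ - (d 3)⁻¹ := by
      simp [Hmat, Matrix.mulVec, dotProduct, Fin.sum_univ_four, hd0]
      try ring
    have g3 : (Hmat.mulVec (fun j => (d j)⁻¹)) 3 = 1 - (d 1)⁻¹ - (d 2)⁻¹ + (d 3)⁻¹ := by
      simp [Hmat, Matrix.mulVec, dotProduct, Fin.sum_univ_four, hd0]
      try ring
    rw [Fin.sum_univ_four, g0, g1, g2, g3]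
    have a0 := le_abs_self (1 + (d 1)⁻¹ + (d 2)⁻¹ + (d 3)⁻¹)
    have a1 := neg_le_abs (1 + (d 1)⁻¹ - (d 2)⁻¹ - (d 3)⁻¹)
    have a2 := neg_le_abs (1 - (d 1)⁻¹ + (d 2)⁻¹ - (d 3)⁻¹)
    have a3 := neg_le_abs (1 - (d 1)⁻¹ - (d 2)⁻¹ + (d 3)⁻¹)
    linarith
  have hp : 0 ≤ (1 + ε) / (1 - ε) := by positivity
  have hsq := pow_le_pow_left₀ hp hn 2
  have hr : 4 * ε / (1 - ε) ^ 2 = ((1 + ε) / (1 - ε)) ^ 2 - 1 := by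
    field_simp
    ring
  rw [hr]
  linarith
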